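/- arXiv:1807.09348 — 4 statements merged into one kernel-verified Lean document; each statement's English description precedes it below -/
import Mathlib

section
/- Let X be a set with at least two elements. Let H and H' be hypergraphs in which every edge has nonempty incidence set of cardinality at most |X|. Then the nerve functor N is faithful on such hypergraphs: for any distinct morphisms f, g : H → H' one has N(f) ≠ N(g). -/
open CategoryTheory Limits Opposite

/-- A hypergraph: a set of edges, a set of vertices, and an incidence map
`inc : E → 𝒫(V)`.  This is an object of the comma category `Set ↓ 𝒫` for the
covariant powerset functor `𝒫`. -/
structure HG : Type 1 where
  E : Type
  Vt : Type
  inc : E → Set Vt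

/-- A morphism of hypergraphs `(f_E, f_V)` with `φ' ∘ f_E = 𝒫(f_V) ∘ φ`
(the powerset functor acts by taking images). -/
@[ext]
structure HGHom (H K : HG) : Type where
  fE : H.E → K.E
  fV : H.Vt → K.Vt
  comm : ∀ e, K.inc (fE e) = fV '' (H.inc e)

instance : Category HG where
  Hom := HGHom
  id H := ⟨id, id, fun e => by simp⟩
  comp {H K L} f g := ⟨g.fE ∘ f.fE, g.fV ∘ f.fV, fun e => by
    simp only [Function.comp_apply, g.comm, f.comm, Set.image_image]⟩
  id_comp f := HGHom.ext rfl rfl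
  comp_id f := HGHom.ext rfl rfl
  assoc f g h := HGHom.ext rfl rfl

/-- The two objects of the theory `𝔾_{(X, Aut X)}`. -/
inductive PObj (X : Type) : Type
  | V | A

namespace PObj

/-- Hom-sets of the theory `𝔾_{(X, Aut X)}`: `Hom(V,A) = X`, `Hom(A,A) = Aut X`. -/
def Homs (X : Type) : PObj X → PObj X → Type
  | V, V => PUnit
  | V, A => X
  | A, V => PEmpty
  | A, A => Equiv.Perm X

/-- The theory `𝔾_{(X, Aut X)}`: composition is given by `σ ∘ x = σ(x)` and
`σ ∘ σ' = σ'σ` (the monoid `Aut X` with its diagrammatic multiplication). -/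
instance (X : Type) : Category (PObj X) where
  Hom := Homs X
  id o := match o with
    | V => PUnit.unit
    | A => (1 : Equiv.Perm X)
  comp {a b c} f g := match a, b, c, f, g with
    | V, V, V, _, _ => PUnit.unit
    | V, V, A, _, x => x
    | V, A, V, _, e => e.elim
    | V, A, A, x, σ => show X from (show Equiv.Perm X from σ) (show X from x)
    | A, V, _, e, _ => e.elim
    | A, A, V, _, e => e.elim
    | A, A, A, σ, τ => show Equiv.Perm X from (show Equiv.Perm X from τ) * (show Equiv.Perm X from σ)
  id_comp {a b} f := by
    cases a <;> cases b <;>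
      first
        | exact f.elim
        | rfl
        | exact mul_one (show Equiv.Perm X from f)
  comp_id {a b} f := by
    cases a <;> cases b <;>
      first
        | exact f.elim
        | rfl
        | exact one_mul (show Equiv.Perm X from f)
  assoc {a b c d} f g h := by
    cases a <;> cases b <;> cases c <;> cases d <;>
      first
        | exact f.elim
        | exact g.elim
        | exact h.elim
        | rfl
        | exact (mul_assoc (show Equiv.Perm X from h) (show Equiv.Perm X from g)
            (show Equiv.Perm X from f)).symm

end PObj

/-- The interpretation functor `I : 𝔾_{(X, Aut X)} ⥤ ℋ`: `V` goes to the one-vertex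
edgeless hypergraph, `A` to the hypergraph with vertex set `X` and one edge incident to
all of `X`; `x : V ⟶ A` selects the vertex `x` and `σ : A ⟶ A` acts by `σ` on vertices. -/
def Interp (X : Type) : PObj X ⥤ HG where
  obj o := match o with
    | .V => ⟨Empty, PUnit, fun e => e.elim⟩
    | .A => ⟨PUnit, X, fun _ => Set.univ⟩
  map {a b} f := match a, b, f with
    | .V, .V, _ => 𝟙 _
    | .V, .A, x => ⟨fun e => e.elim, fun _ => (show X from x), fun e => e.elim⟩
    | .A, .V, e => e.elim
    | .A, .A, σ => ⟨id, show Equiv.Perm X from σ, fun _ => by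
        simpa using ((show Equiv.Perm X from σ).surjective.range_eq).symm⟩
  map_id o := by
    cases o
    · rfl
    · exact HGHom.ext rfl rfl
  map_comp {a b c} f g := by
    cases a <;> cases b <;> cases c <;>
      first
        | exact f.elim
        | exact g.elim
        | exact HGHom.ext rfl rfl

/-- The nerve `N : ℋ ⥤ presheaves on 𝔾_{(X, Aut X)}`, `N(H) = ℋ(I(−), H)`. -/
def nerveHG (X : Type) : HG ⥤ ((PObj X)ᵒᵖ ⥤ Type) :=
  yoneda ⋙ (Functor.whiskeringLeft (PObj X)ᵒᵖ HGᵒᵖ Type).obj (Interp X).op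

/-- For `X` with at least two elements, the nerve `N` of the interpretation
`I : 𝔾_{(X, Aut X)} ⥤ ℋ` is faithful on hypergraphs all of whose edges have nonempty
incidence of cardinality at most `|X|`. -/
theorem statement8 (X : Type) (hX : Nontrivial X) (H H' : HG)
    (hH : ∀ e : H.E, (H.inc e).Nonempty ∧ Cardinal.mk (H.inc e) ≤ Cardinal.mk X)
    (hH' : ∀ e : H'.E, (H'.inc e).Nonempty ∧ Cardinal.mk (H'.inc e) ≤ Cardinal.mk X)
    (f g : H ⟶ H') (hfg : f ≠ g) :
    (nerveHG X).map f ≠ (nerveHG X).map g := by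
  intro h
  have key : ∀ (o : PObj X) (a : (Interp X).obj o ⟶ H), a ≫ f = a ≫ g := by
    intro o a
    have h1 := congrArg (fun t => t.app (op o)) h
    exact congrArg (fun t => t a) h1
  apply hfg
  apply HGHom.ext
  · funext e
    obtain ⟨hne, hle⟩ := hH e
    haveI : Nonempty (H.inc e) := hne.to_subtype
    obtain ⟨i⟩ := (Cardinal.le_def _ _).1 hle
    have hs : Function.Surjective (Function.invFun i) := Function.invFun_surjective i.injective
    let a : HGHom ((Interp X).obj PObj.A) H :=
      ⟨fun _ => e, fun x => (Function.invFun i x : H.inc e).1, fun _ => by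
        ext v
        constructor
        · intro hv
          obtain ⟨x, hx⟩ := hs ⟨v, hv⟩
          exact ⟨x, trivial, congrArg Subtype.val hx⟩
        · rintro ⟨x, -, rfl⟩
          exact Subtype.property _⟩
    exact congrFun (congrArg HGHom.fE (key PObj.A a)) PUnit.unit
  · funext v
    let a : HGHom ((Interp X).obj PObj.V) H :=
      ⟨fun e => Empty.elim e, fun _ => v, fun e => Empty.elim e⟩
    exact congrFun (congrArg HGHom.fV (key PObj.V a)) PUnit.unit
end

section
/- Let X be a set with at least two elements and let H be a hypergraph in which every edge has nonempty incidence set of cardinality at most |X|. Then the counit component ε_H : RN(H) → H of the nerve–realization adjunction R ⊣ N induced by the interpretation I : 𝔾_{(X,Aut(X))} → ℋ is an epimorphism. -/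
open CategoryTheory Limits Opposite

namespace CategoryTheory.Presheaf

universe v₁ u₁ u₂

/-- The functor `ℰ ⥤ Cᵒᵖ ⥤ Type v₁` sending `E` to the presheaf `Hom(A -, E)`
(formerly in Mathlib). -/
def restrictedYoneda {C : Type u₁} [Category.{v₁} C] {ℰ : Type u₂} [Category.{v₁} ℰ]
    (A : C ⥤ ℰ) : ℰ ⥤ Cᵒᵖ ⥤ Type v₁ :=
  yoneda ⋙ (Functor.whiskeringLeft _ _ (Type v₁)).obj (Functor.op A)

/-- Auxiliary definition for `restrictedYonedaHomEquiv` (formerly in Mathlib). -/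
def restrictedYonedaHomEquiv' {C : Type u₁} [Category.{v₁} C] {ℰ : Type u₂} [Category.{v₁} ℰ]
    (A : C ⥤ ℰ) (P : Cᵒᵖ ⥤ Type v₁) (E : ℰ) :
    (CostructuredArrow.proj yoneda P ⋙ A ⟶
      (Functor.const (CostructuredArrow yoneda P)).obj E) ≃
      (P ⟶ (restrictedYoneda A).obj E) where
  toFun f :=
    { app := fun _ => ↾fun x => f.app (CostructuredArrow.mk (yonedaEquiv.symm x))
      naturality := fun X₁ X₂ φ => by
        ext x
        let ψ : CostructuredArrow.mk (yonedaEquiv.symm (P.map φ x)) ⟶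
            CostructuredArrow.mk (yonedaEquiv.symm x) :=
          CostructuredArrow.homMk φ.unop (by
            dsimp
            rw [yonedaEquiv_symm_map])
        exact ((f.naturality ψ).trans (Category.comp_id _)).symm }
  invFun g :=
    { app := fun y => yonedaEquiv (y.hom ≫ g)
      naturality := fun X₁ X₂ φ => by
        refine Eq.trans ?_ (Category.comp_id _).symm
        rw [← CostructuredArrow.w φ, Category.assoc]
        exact yonedaEquiv_naturality (X₂.hom ≫ g) φ.left }
  left_inv f := by
    ext X
    let e : CostructuredArrow.mk (yonedaEquiv.symm (yonedaEquiv X.hom)) ≅ X :=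
      CostructuredArrow.isoMk (Iso.refl _) (by simp)
    have h : ∀ a b : A.obj X.left ⟶ E, A.map (𝟙 X.left) ≫ a = b ≫ 𝟙 E → a = b := by
      intro a b hab
      simpa using hab
    exact h _ _ (f.naturality e.inv)
  right_inv g := by
    ext X x
    have : yonedaEquiv (yonedaEquiv.symm x ≫ g) = g.app X x := by
      rw [yonedaEquiv_comp, Equiv.apply_symm_apply]
    exact this

/-- Auxiliary definition for `yonedaAdjunction` (formerly in Mathlib). -/
noncomputable def restrictedYonedaHomEquiv {C : Type u₁} [Category.{v₁} C]
    {ℰ : Type u₂} [Category.{v₁} ℰ] {A : C ⥤ ℰ}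
    [yoneda.HasPointwiseLeftKanExtension A]
    (L : (Cᵒᵖ ⥤ Type v₁) ⥤ ℰ) (α : A ⟶ yoneda ⋙ L) [L.IsLeftKanExtension α]
    (P : Cᵒᵖ ⥤ Type v₁) (E : ℰ) :
    (L.obj P ⟶ E) ≃ (P ⟶ (restrictedYoneda A).obj E) :=
  (Functor.isPointwiseLeftKanExtensionOfIsLeftKanExtension _ α P).homEquiv.trans
    (restrictedYonedaHomEquiv' A P E)

/-- If `L : (Cᵒᵖ ⥤ Type v₁) ⥤ ℰ` is a pointwise left Kan extension of a functor `A : C ⥤ ℰ`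
along the Yoneda embedding, then `L` is a left adjoint of `restrictedYoneda A`
(formerly in Mathlib). -/
noncomputable def yonedaAdjunction {C : Type u₁} [Category.{v₁} C]
    {ℰ : Type u₂} [Category.{v₁} ℰ] {A : C ⥤ ℰ}
    [yoneda.HasPointwiseLeftKanExtension A]
    (L : (Cᵒᵖ ⥤ Type v₁) ⥤ ℰ) (α : A ⟶ yoneda ⋙ L) [L.IsLeftKanExtension α] :
    L ⊣ restrictedYoneda A :=
  Adjunction.mkOfHomEquiv
    { homEquiv := fun P E => restrictedYonedaHomEquiv L α P E
      homEquiv_naturality_left_symm := fun {P Q X} f g => by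
        apply (Functor.isPointwiseLeftKanExtensionOfIsLeftKanExtension L α P).hom_ext
        intro p
        have hfg := (Functor.isPointwiseLeftKanExtensionOfIsLeftKanExtension
          L α P).comp_homEquiv_symm ((restrictedYonedaHomEquiv' A P X).symm (f ≫ g)) p
        have hg := (Functor.isPointwiseLeftKanExtensionOfIsLeftKanExtension
          L α Q).comp_homEquiv_symm ((restrictedYonedaHomEquiv' A Q X).symm g)
            ((CostructuredArrow.map f).obj p)
        refine (Category.assoc _ _ _).trans (hfg.trans (Eq.trans hg.symm ?_))
        have h : ∀ k : L.obj Q ⟶ X, α.app p.left ≫ L.map (p.hom ≫ f) ≫ k =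
            (α.app p.left ≫ L.map p.hom) ≫ L.map f ≫ k := by
          intro k
          rw [L.map_comp, Category.assoc, Category.assoc]
        exact h _
      homEquiv_naturality_right := fun {P X Y} f g => by
        ext Z x
        exact (Category.assoc _ _ _).symm }

end CategoryTheory.Presheaf

/-- The covariant powerset functor `𝒫 : Set ⥤ Set`. -/
def PowF : Type ⥤ Type where
  obj Y := Set Y
  map f := ↾(Set.image f)
  map_id Y := by refine ConcreteCategory.hom_ext _ _ fun S => ?_; exact Set.image_id S
  map_comp {Y Z W} f g := by refine ConcreteCategory.hom_ext _ _ fun S => ?_; exact Set.image_comp g f S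

/-- The category of hypergraphs, as the comma category `Set ↓ 𝒫`. -/
abbrev HGc : Type 1 := Comma (𝟭 Type) PowF

noncomputable example : HasColimits HGc := inferInstance

/-- The interpretation functor `I : 𝔾_{(X, Aut X)} ⥤ ℋ`. -/
def InterpC (X : Type) : PObj X ⥤ HGc where
  obj o := match o with
    | .V => ⟨Empty, PUnit, ↾fun e : Empty => e.elim⟩
    | .A => ⟨PUnit, X, ↾fun _ => (Set.univ : Set X)⟩
  map {a b} f := match a, b, f with
    | .V, .V, _ => 𝟙 _
    | .V, .A, x =>
        { left := ↾fun e : Empty => e.elim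
          right := ↾fun _ => (show X from x)
          w := by refine ConcreteCategory.hom_ext _ _ fun e => ?_; exact Empty.elim e }
    | .A, .V, e => e.elim
    | .A, .A, σ =>
        { left := ↾id
          right := ↾(show Equiv.Perm X from σ)
          w := by
            refine ConcreteCategory.hom_ext _ _ fun u => ?_
            exact (by simpa using ((show Equiv.Perm X from σ).surjective.range_eq.symm) :
              (Set.univ : Set X) = (show Equiv.Perm X from σ) '' Set.univ) }
  map_id o := by
    cases o
    · rfl
    · apply CommaMorphism.ext <;> rfl
  map_comp {a b c} f g := by
    cases a <;> cases b <;> cases c <;>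
      first
        | exact f.elim
        | exact g.elim
        | apply CommaMorphism.ext <;> rfl

/-- for `X` with at least two elements and a hypergraph `H` all of whose
edges have nonempty incidence of cardinality at most `|X|`, the counit component
`ε_H : RN(H) ⟶ H` of the nerve–realization adjunction `R ⊣ N` induced by the
interpretation `I : 𝔾_{(X, Aut X)} ⥤ ℋ` is an epimorphism. -/
theorem statement9 (X : Type) (hX : Nontrivial X) (H : HGc)
    (hH : ∀ e : H.left, (show Set H.right from H.hom e).Nonempty ∧
      Cardinal.mk (show Set H.right from H.hom e) ≤ Cardinal.mk X) :
    Epi ((Presheaf.yonedaAdjunction (yoneda.leftKanExtension (InterpC X))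
      (yoneda.leftKanExtensionUnit (InterpC X))).counit.app H) := by
  constructor
  intro Z g h hgh
  let adj := Presheaf.yonedaAdjunction (yoneda.leftKanExtension (InterpC X))
      (yoneda.leftKanExtensionUnit (InterpC X))
  have hN : (Presheaf.restrictedYoneda (InterpC X)).map g =
      (Presheaf.restrictedYoneda (InterpC X)).map h := by
    apply (adj.homEquiv _ _).symm.injective
    rw [adj.homEquiv_counit, adj.homEquiv_counit]
    exact (adj.counit.naturality g).trans (hgh.trans (adj.counit.naturality h).symm)
  have key : ∀ (o : PObj X) (f : (InterpC X).obj o ⟶ H), f ≫ g = f ≫ h := by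
    intro o f
    exact congrArg (fun t => (t.app (op o)) f) hN
  apply CommaMorphism.ext
  · refine ConcreteCategory.hom_ext _ _ fun e => ?_
    obtain ⟨hne, hc⟩ := hH e
    obtain ⟨j⟩ := hc
    haveI : Nonempty (show Set H.right from H.hom e) := hne.to_subtype
    have hs := Function.invFun_surjective j.injective
    let p : X → H.right := fun x => (Function.invFun j x).1
    have hp : (show Set H.right from H.hom e) = p '' Set.univ := by
      ext v
      constructor
      · intro hv
        obtain ⟨x, hx⟩ := hs ⟨v, hv⟩
        exact ⟨x, trivial, congrArg Subtype.val hx⟩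
      · rintro ⟨x, -, rfl⟩
        exact (Function.invFun j x).2
    let f : (InterpC X).obj .A ⟶ H :=
      { left := ↾fun _ => e
        right := ↾p
        w := by
          refine ConcreteCategory.hom_ext _ _ fun u => ?_
          exact hp }
    exact congrArg (fun t => t.left PUnit.unit) (key _ f)
  · refine ConcreteCategory.hom_ext _ _ fun v => ?_
    let f : (InterpC X).obj .V ⟶ H :=
      { left := ↾fun e : Empty => e.elim
        right := ↾fun _ => v
        w := by
          refine ConcreteCategory.hom_ext _ _ fun u => ?_
          exact Empty.elim u }
    exact congrArg (fun t => t.right PUnit.unit) (key _ f)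
end

section
/- Let Q be a hypergraph and set X := Q(V). Then Q is an injective object of the category of hypergraphs if and only if Q has an edge with empty incidence and the nerve N(Q) is an injective object of the presheaf category of (X,Aut(X))-graphs, where N is the nerve of the interpretation I : 𝔾_{(X,Aut(X))} → ℋ. -/
open CategoryTheory Limits Opposite

theorem HG.comp_fV {H K L : HG} (f : H ⟶ K) (g : K ⟶ L) (v : H.Vt) :
    HGHom.fV (f ≫ g) v = HGHom.fV g (HGHom.fV f v) := rfl

theorem HG.comp_fE {H K L : HG} (f : H ⟶ K) (g : K ⟶ L) (v : H.E) :
    HGHom.fE (f ≫ g) v = HGHom.fE g (HGHom.fE f v) := rfl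

theorem HG.mono_of_injective {H K : HG} (f : H ⟶ K) (hE : Function.Injective (HGHom.fE f))
    (hV : Function.Injective (HGHom.fV f)) : Mono f := by
  constructor
  intro Z g h hgh
  apply HGHom.ext
  · funext e
    apply hE
    exact congrFun (congrArg HGHom.fE hgh) e
  · funext v
    apply hV
    exact congrFun (congrArg HGHom.fV hgh) v

theorem HG.injective_fV_of_mono {H K : HG} (f : H ⟶ K) [Mono f] :
    Function.Injective (HGHom.fV f) := by
  intro a b hab
  let P : HG := ⟨Empty, PUnit, fun e => e.elim⟩
  let g (a : H.Vt) : P ⟶ H := ⟨fun e => e.elim, fun _ => a, fun e => e.elim⟩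
  have h : g a ≫ f = g b ≫ f :=
    HGHom.ext (funext fun e => e.elim) (funext fun _ => hab)
  have h2 := (cancel_mono f).1 h
  exact congrFun (congrArg HGHom.fV h2) PUnit.unit

theorem HG.injective_fE_of_mono {H K : HG} (f : H ⟶ K) [Mono f] :
    Function.Injective (HGHom.fE f) := by
  intro a b hab
  have hV := HG.injective_fV_of_mono f
  have hinc : H.inc a = H.inc b := by
    apply hV.image_injective
    rw [← HGHom.comm f, ← HGHom.comm f, hab]
  let P : HG := ⟨PUnit, H.Vt, fun _ => H.inc a⟩
  let g : P ⟶ H := ⟨fun _ => a, id, fun e => by simp [P]⟩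
  let g' : P ⟶ H := ⟨fun _ => b, id, fun e => by simp [P, hinc]⟩
  have h : g ≫ f = g' ≫ f := HGHom.ext (funext fun e => hab) rfl
  have h2 := (cancel_mono f).1 h
  exact congrFun (congrArg HGHom.fE h2) PUnit.unit

theorem HG.injective_iff (Q : HG) :
    Injective Q ↔ Nonempty Q.Vt ∧ Function.Surjective Q.inc := by
  constructor
  · intro hQ
    constructor
    · let H : HG := ⟨Empty, Empty, fun e => e.elim⟩
      let K : HG := ⟨Empty, PUnit, fun e => e.elim⟩
      let m : H ⟶ K := ⟨id, fun e => e.elim, fun e => e.elim⟩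
      let f : H ⟶ Q := ⟨fun e => e.elim, fun e => e.elim, fun e => e.elim⟩
      have : Mono m := HG.mono_of_injective m (fun a => a.elim) (fun a => a.elim)
      obtain ⟨h, _⟩ := hQ.factors f m
      exact ⟨HGHom.fV h PUnit.unit⟩
    · intro S
      let H : HG := ⟨Empty, Q.Vt, fun e => e.elim⟩
      let K : HG := ⟨PUnit, Q.Vt, fun _ => S⟩
      let m : H ⟶ K := ⟨fun e => e.elim, id, fun e => e.elim⟩
      let f : H ⟶ Q := ⟨fun e => e.elim, id, fun e => e.elim⟩
      have : Mono m := HG.mono_of_injective m (fun a => a.elim) (fun a b h => h)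
      obtain ⟨h, hh⟩ := hQ.factors f m
      have hv : HGHom.fV h = id := congrArg HGHom.fV hh
      refine ⟨HGHom.fE h PUnit.unit, ?_⟩
      rw [HGHom.comm h, hv]
      simp [K]
  · rintro ⟨⟨v₀⟩, hs⟩
    constructor
    intro H K f m _
    classical
    have hV := HG.injective_fV_of_mono m
    have hE := HG.injective_fE_of_mono m
    let kV : K.Vt → Q.Vt := Function.extend (HGHom.fV m) (HGHom.fV f) (fun _ => v₀)
    let kE : K.E → Q.E := Function.extend (HGHom.fE m) (HGHom.fE f)
      (fun e => Function.surjInv hs (kV '' K.inc e))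
    have hkV : ∀ v, kV (HGHom.fV m v) = HGHom.fV f v := fun v => hV.extend_apply _ _ v
    have hkE : ∀ v, kE (HGHom.fE m v) = HGHom.fE f v := fun v => hE.extend_apply _ _ v
    refine ⟨⟨kE, kV, ?_⟩, HGHom.ext (funext hkE) (funext hkV)⟩
    intro e
    by_cases he : ∃ a, HGHom.fE m a = e
    · obtain ⟨a, rfl⟩ := he
      rw [hkE, HGHom.comm f, HGHom.comm m, Set.image_image]
      simp only [hkV]
    · have : kE e = Function.surjInv hs (kV '' K.inc e) := Function.extend_apply' _ _ _ he
      rw [this]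
      exact Function.surjInv_eq hs _

/-- The vertex map of a hypergraph morphism. -/
def HG.vmap {H K : HG} (f : H ⟶ K) : H.Vt → K.Vt := HGHom.fV f

/-- The permutation underlying an endomorphism of `A`. -/
def PObj.toPerm {X : Type} (σ : (PObj.A : PObj X) ⟶ PObj.A) : Equiv.Perm X := σ

/-- The endomorphism of `A` given by a permutation. -/
def PObj.ofPerm {X : Type} (σ : Equiv.Perm X) : (PObj.A : PObj X) ⟶ PObj.A := σ

/-- The morphism `V ⟶ A` given by `x`. -/
def PObj.pt {X : Type} (x : X) : (PObj.V : PObj X) ⟶ PObj.A := x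

/-- The underlying hypergraph morphism of an element of the nerve. -/
def nerveElt {X : Type} {Q : HG} {U : (PObj X)ᵒᵖ} (a : ((nerveHG X).obj Q).obj U) :
    (Interp X).obj U.unop ⟶ Q := a

theorem nerve_surj (Q : HG) (hN : Injective ((nerveHG Q.Vt).obj Q)) (S : Set Q.Vt)
    (hS : S.Nonempty) : ∃ e, Q.inc e = S := by
  classical
  obtain ⟨s₀, hs₀⟩ := hS
  let g : Q.Vt → Q.Vt := fun x => if x ∈ S then x else s₀
  have hg : g '' Set.univ = S := by
    ext y
    constructor
    · rintro ⟨x, -, rfl⟩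
      by_cases hx : x ∈ S <;> simp [g, hx, hs₀]
    · intro hy
      exact ⟨y, trivial, by simp [g, hy]⟩
  let F : Subfunctor (yoneda.obj (PObj.A : PObj Q.Vt)) :=
    { obj := fun U => {_x | U.unop = PObj.V}
      map := by
        rintro ⟨U⟩ ⟨W⟩ i x hx
        have hx : U = PObj.V := hx
        subst hx
        change W = PObj.V
        cases W
        · rfl
        · exact PEmpty.elim i.unop }
  let f : F.toFunctor ⟶ (nerveHG Q.Vt).obj Q :=
    { app := fun U => TypeCat.ofHom fun p =>
        (⟨fun e => by
            have h : U.unop = PObj.V := p.2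
            rw [h] at e
            exact e.elim,
          fun v => g (HG.vmap (K := (Interp Q.Vt).obj PObj.A) ((Interp Q.Vt).map p.1) v),
          fun e => by
            have h : U.unop = PObj.V := p.2
            rw [h] at e
            exact e.elim⟩ : HGHom ((Interp Q.Vt).obj U.unop) Q)
      naturality := by
        rintro ⟨U⟩ ⟨W⟩ i
        ext p
        have h : W = PObj.V := (F.toFunctor.map i p).2
        subst h
        apply HGHom.ext
        · funext e
          exact e.elim
        · funext v
          change g _ = g _
          congr 1
          change HG.vmap ((Interp Q.Vt).map (i.unop ≫ p.1)) v = _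
          rw [Functor.map_comp]
          rfl }
  obtain ⟨h, hh⟩ := hN.factors f F.ι
  let idA : (yoneda.obj (PObj.A : PObj Q.Vt)).obj (op PObj.A) := 𝟙 (PObj.A : PObj Q.Vt)
  let k : HGHom ((Interp Q.Vt).obj PObj.A) Q := nerveElt (h.app (op PObj.A) idA)
  have hk : ∀ x : Q.Vt, k.fV x = g x := by
    intro x
    have h1 := ConcreteCategory.congr_hom (h.naturality (PObj.pt x).op) idA
    have h2 := ConcreteCategory.congr_hom (NatTrans.congr_app hh (op PObj.V))
      ⟨PObj.pt x, rfl⟩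
    have h3 := congrFun (congrArg HGHom.fV (h1 : (_ : HGHom ((Interp Q.Vt).obj PObj.V) Q) = _))
      PUnit.unit
    have h4 := congrFun (congrArg HGHom.fV (h2 : (_ : HGHom ((Interp Q.Vt).obj PObj.V) Q) = _))
      PUnit.unit
    exact h3.symm.trans h4
  refine ⟨k.fE PUnit.unit, ?_⟩
  have h5 : k.fV = g := funext hk
  have h6 : Q.inc (k.fE PUnit.unit) = k.fV '' Set.univ := k.comm PUnit.unit
  exact h6.trans ((congrArg (fun q : Q.Vt → Q.Vt => q '' Set.univ) h5).trans hg)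

theorem nerve_nonempty (Q : HG) (hN : Injective ((nerveHG Q.Vt).obj Q)) : Nonempty Q.Vt := by
  let F : Subfunctor (yoneda.obj (PObj.V : PObj Q.Vt)) := ⊥
  let f : F.toFunctor ⟶ (nerveHG Q.Vt).obj Q :=
    { app := fun U => TypeCat.ofHom fun p => False.elim p.2
      naturality := by
        intro U W i
        ext p
        exact False.elim p.2 }
  obtain ⟨h, _⟩ := hN.factors f F.ι
  let k : HGHom ((Interp Q.Vt).obj PObj.V) Q :=
    nerveElt (h.app (op PObj.V) (𝟙 (PObj.V : PObj Q.Vt)))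
  exact ⟨k.fV PUnit.unit⟩

theorem nerve_injective (X : Type) (Q : HG) (v₀ : Q.Vt) (hs : Function.Surjective Q.inc) :
    Injective ((nerveHG X).obj Q) := by
  constructor
  intro F G f m hm
  classical
  have hinj : ∀ U, Function.Injective (m.app U) := fun U =>
    (mono_iff_injective _).1 ((NatTrans.mono_iff_mono_app m).1 hm U)
  let fV : F.obj (op PObj.V) → Q.Vt := fun u => HGHom.fV (nerveElt (f.app _ u)) PUnit.unit
  let fE : F.obj (op PObj.A) → Q.E := fun u => HGHom.fE (nerveElt (f.app _ u)) PUnit.unit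
  have hfV : ∀ (b : F.obj (op PObj.A)) (x : X),
      HGHom.fV (nerveElt (f.app _ b)) x = fV (F.map (PObj.pt x).op b) := by
    intro b x
    have h1 := ConcreteCategory.congr_hom (f.naturality (PObj.pt x).op) b
    have h3 := congrFun (congrArg HGHom.fV (h1 : (_ : HGHom ((Interp X).obj PObj.V) Q) = _))
      PUnit.unit
    exact h3.symm
  let kV : G.obj (op PObj.V) → Q.Vt := Function.extend (m.app (op PObj.V)) fV (fun _ => v₀)
  have hkV : ∀ u, kV (m.app _ u) = fV u := fun u => (hinj _).extend_apply _ _ u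
  let kg : G.obj (op PObj.A) → X → Q.Vt := fun a x => kV (G.map (PObj.pt x).op a)
  have hkg : ∀ (b : F.obj (op PObj.A)) (x : X),
      kg (m.app _ b) x = HGHom.fV (nerveElt (f.app _ b)) x := by
    intro b x
    have h1 : m.app _ (F.map (PObj.pt x).op b) = G.map (PObj.pt x).op (m.app _ b) :=
      ConcreteCategory.congr_hom (m.naturality (PObj.pt x).op) b
    rw [hfV, ← hkV, h1]
  let kE : G.obj (op PObj.A) → Q.E := Function.extend (m.app (op PObj.A)) fE
    (fun a => Function.surjInv hs (kg a '' Set.univ))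
  have hkE : ∀ u, kE (m.app _ u) = fE u := fun u => (hinj _).extend_apply _ _ u
  have hkE' : ∀ a, (¬ ∃ b, m.app _ b = a) → kE a = Function.surjInv hs (kg a '' Set.univ) :=
    fun a ha => Function.extend_apply' _ _ _ ha
  have hcomm : ∀ a, Q.inc (kE a) = kg a '' Set.univ := by
    intro a
    by_cases ha : ∃ b, m.app _ b = a
    · obtain ⟨b, rfl⟩ := ha
      rw [hkE]
      have : kg (m.app _ b) = HGHom.fV (nerveElt (f.app _ b)) := funext (hkg b)
      rw [this]
      exact HGHom.comm (nerveElt (f.app _ b)) PUnit.unit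
    · rw [hkE' a ha]
      exact Function.surjInv_eq hs _
  have hgσ : ∀ (σ : (PObj.A : PObj X) ⟶ PObj.A) (a : G.obj (op PObj.A)) (x : X),
      kg (G.map σ.op a) x = kg a ((PObj.toPerm σ) x) := by
    intro σ a x
    have : G.map (PObj.pt x).op (G.map σ.op a) = G.map (PObj.pt x ≫ σ).op a := by
      rw [op_comp, Functor.map_comp]
      rfl
    change kV _ = kV _
    rw [this]
    rfl
  have hEσ : ∀ (σ : (PObj.A : PObj X) ⟶ PObj.A) (a : G.obj (op PObj.A)),
      kE (G.map σ.op a) = kE a := by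
    intro σ a
    by_cases ha : ∃ b, m.app _ b = a
    · obtain ⟨b, rfl⟩ := ha
      have h1 : m.app _ (F.map σ.op b) = G.map σ.op (m.app _ b) :=
        ConcreteCategory.congr_hom (m.naturality σ.op) b
      rw [← h1, hkE, hkE]
      have h2 := ConcreteCategory.congr_hom (f.naturality σ.op) b
      exact congrFun (congrArg HGHom.fE (h2 : (_ : HGHom ((Interp X).obj PObj.A) Q) = _))
        PUnit.unit
    · have ha' : ¬ ∃ b, m.app _ b = G.map σ.op a := by
        rintro ⟨b, hb⟩
        apply ha
        let τ : (PObj.A : PObj X) ⟶ PObj.A := PObj.ofPerm (PObj.toPerm σ)⁻¹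
        have hτ : τ ≫ σ = 𝟙 _ := mul_inv_cancel (PObj.toPerm σ)
        refine ⟨F.map τ.op b, ?_⟩
        have h1 : m.app _ (F.map τ.op b) = G.map τ.op (m.app _ b) :=
          ConcreteCategory.congr_hom (m.naturality τ.op) b
        rw [h1, hb]
        have h2 : G.map τ.op (G.map σ.op a) = G.map (τ ≫ σ).op a := by
          rw [op_comp, Functor.map_comp]
          rfl
        rw [h2, hτ, op_id, CategoryTheory.Functor.map_id]
        rfl
      rw [hkE' _ ha, hkE' _ ha']
      congr 1
      have : kg (G.map σ.op a) = kg a ∘ (PObj.toPerm σ) := funext (hgσ σ a)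
      rw [this, Set.image_comp, Set.image_univ_of_surjective (Equiv.surjective _)]
  let kApp : ∀ U : PObj X, G.obj (op U) → HGHom ((Interp X).obj U) Q := fun U =>
    match U with
    | .V => fun u => ⟨fun e => Empty.elim e, fun _ => kV u, fun e => Empty.elim e⟩
    | .A => fun a => ⟨fun _ => kE a, kg a, fun _ => hcomm a⟩
  let k : G ⟶ (nerveHG X).obj Q :=
    { app := fun U => TypeCat.ofHom (kApp U.unop)
      naturality := by
        rintro ⟨U⟩ ⟨W⟩ ⟨i⟩
        change W ⟶ U at i
        ext a
        change kApp W (G.map i.op a) = (show HGHom ((Interp X).obj W) Q from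
          (Interp X).map i ≫ (show (Interp X).obj U ⟶ Q from kApp U a))
        cases U <;> cases W
        · have hi : i = 𝟙 _ := rfl
          subst hi
          rw [op_id, CategoryTheory.Functor.map_id]
          exact HGHom.ext (funext fun e => Empty.elim e) rfl
        · exact PEmpty.elim i
        · exact HGHom.ext (funext fun e => Empty.elim e) rfl
        · exact HGHom.ext (funext fun _ => hEσ i a) (funext fun x => hgσ i a x) }
  refine ⟨k, ?_⟩
  ext ⟨U⟩ a
  change kApp U (m.app _ a) = (show HGHom ((Interp X).obj U) Q from nerveElt (f.app _ a))
  cases U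
  · exact HGHom.ext (funext fun e => Empty.elim e) (funext fun _ => hkV a)
  · exact HGHom.ext (funext fun _ => hkE a) (funext fun x => hkg a x)

/-- Let `Q` be a hypergraph and `X := Q(V)`.  Then `Q` is an injective
hypergraph iff `Q` has an edge with empty incidence and the nerve `N(Q)` is an injective
object of the presheaf category of `(X, Aut X)`-graphs. -/
theorem statement14 (Q : HG) :
    Injective Q ↔
      ((∃ e : Q.E, Q.inc e = (∅ : Set Q.Vt)) ∧ Injective ((nerveHG Q.Vt).obj Q)) := by
  rw [HG.injective_iff]
  constructor
  · rintro ⟨⟨v₀⟩, hs⟩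
    exact ⟨hs ∅, nerve_injective Q.Vt Q v₀ hs⟩
  · rintro ⟨he, hN⟩
    refine ⟨nerve_nonempty Q hN, fun S => ?_⟩
    rcases S.eq_empty_or_nonempty with rfl | hS
    · exact he
    · exact nerve_surj Q hN S hS
end

section
/- The interpretation functor I : 𝔾_{(X,Aut(X))} → Set↓Π̲_X is dense: for every Π̲_X-graph G, the canonical cocone from the diagram (I↓G) → Set↓Π̲_X, (c,φ) ↦ I(c), to G is a colimit cocone. -/
open CategoryTheory Limits Opposite

/-- The symmetric `X`-power functor `Π̲_X : Set ⥤ Set`: `Π̲_X(Y)` is the quotient of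
`Y^X` by precomposition with the automorphism group `Aut X`. -/
def PiXF (X : Type) : Type ⥤ Type where
  obj Y := Quot (fun f g : X → Y => ∃ σ : Equiv.Perm X, f = g ∘ σ)
  map {Y Z} h := ↾(Quot.lift (fun f => Quot.mk _ (h ∘ f)) (by
    rintro f g ⟨σ, rfl⟩
    exact Quot.sound ⟨σ, rfl⟩))
  map_id Y := by
    refine ConcreteCategory.hom_ext _ _ fun q => ?_
    induction q using Quot.ind with
    | _ f => rfl
  map_comp {Y Z W} h k := by
    refine ConcreteCategory.hom_ext _ _ fun q => ?_
    induction q using Quot.ind with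
    | _ f => rfl

/-- The category of `Π̲_X`-graphs, the comma category `Set ↓ Π̲_X`. -/
abbrev PiGraph (X : Type) : Type 1 := Comma (𝟭 Type) (PiXF X)

/-- The interpretation functor `I : 𝔾_{(X, Aut X)} ⥤ Set ↓ Π̲_X`: `V ↦ (∅, 1, !)`,
`A ↦ (1, X, ⌜q⌝)` where `q` is the class of `id_X` in `Π̲_X(X)`. -/
def InterpPi (X : Type) : PObj X ⥤ PiGraph X where
  obj o := match o with
    | .V => ⟨Empty, PUnit, ↾fun e => e.elim⟩
    | .A => ⟨PUnit, X, ↾fun _ => Quot.mk _ id⟩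
  map {a b} f := match a, b, f with
    | .V, .V, _ => 𝟙 _
    | .V, .A, x =>
        { left := ↾fun e => e.elim
          right := ↾fun _ => (show X from x)
          w := by refine ConcreteCategory.hom_ext _ _ fun e => ?_; exact e.elim }
    | .A, .V, e => e.elim
    | .A, .A, σ =>
        { left := ↾id
          right := ↾(⇑(show Equiv.Perm X from σ))
          w := by
            refine ConcreteCategory.hom_ext _ _ fun u => ?_
            exact Quot.sound (r := fun f g : X → X => ∃ τ : Equiv.Perm X, f = g ∘ τ)
              ⟨(show Equiv.Perm X from σ)⁻¹, by
                funext y; exact ((show Equiv.Perm X from σ).apply_symm_apply y).symm⟩ }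
  map_id o := by
    cases o
    · rfl
    · apply CommaMorphism.ext <;> rfl
  map_comp {a b c} f g := by
    cases a <;> cases b <;> cases c <;>
      first
        | exact f.elim
        | exact g.elim
        | apply CommaMorphism.ext <;> rfl

/-- The nerve `N := Hom(I(−), −) : Set ↓ Π̲_X ⥤ presheaves on 𝔾_{(X, Aut X)}`. -/
noncomputable def nervePi (X : Type) : PiGraph X ⥤ ((PObj X)ᵒᵖ ⥤ Type) :=
  yoneda ⋙ (Functor.whiskeringLeft _ _ (Type)).obj (Functor.op (InterpPi X))

/-- The canonical cocone on the diagram `(I ↓ G) ⥤ Set ↓ Π̲_X`, `(c, φ) ↦ I(c)`,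
with apex `G`, whose components are the structure morphisms `φ : I(c) ⟶ G`. -/
def canonicalCocone (X : Type) (G : PiGraph X) :
    Cocone (CostructuredArrow.proj (InterpPi X) G ⋙ InterpPi X) where
  pt := G
  ι :=
    { app := fun f => f.hom
      naturality := fun f g m => (CostructuredArrow.w m).trans (Category.comp_id _).symm }

/-- Two functions with the same class differ by a permutation. -/
theorem quot_exact {X Y : Type} {f g : X → Y}
    (h : Quot.mk (fun f g : X → Y => ∃ σ : Equiv.Perm X, f = g ∘ σ) f = Quot.mk _ g) :
    ∃ σ : Equiv.Perm X, f = g ∘ σ := by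
  have h' := Quot.eqvGen_exact h
  clear h
  induction h' with
  | rel _ _ h => exact h
  | refl _ => exact ⟨1, rfl⟩
  | symm _ _ h ih =>
    obtain ⟨σ, rfl⟩ := ih
    exact ⟨σ⁻¹, by funext y; simp⟩
  | trans _ _ _ h1 h2 ih1 ih2 =>
    obtain ⟨σ, rfl⟩ := ih1
    obtain ⟨τ, rfl⟩ := ih2
    exact ⟨τ * σ, rfl⟩

/-- The vertex `v` as a morphism `I(V) ⟶ G`. -/
def vHom {X : Type} (G : PiGraph X) (v : G.right) :
    (InterpPi X).obj PObj.V ⟶ G where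
  left := ↾fun e => (show Empty from e).elim
  right := ↾fun _ => v
  w := by refine ConcreteCategory.hom_ext _ _ fun e => ?_; exact (show Empty from e).elim

/-- The edge `e` with chosen parametrisation `f` as a morphism `I(A) ⟶ G`. -/
def aHom {X : Type} (G : PiGraph X) (e : G.left) (f : X → G.right)
    (h : G.hom e = Quot.mk _ f) :
    (InterpPi X).obj PObj.A ⟶ G where
  left := ↾fun _ => e
  right := ↾f
  w := by refine ConcreteCategory.hom_ext _ _ fun _ => ?_; exact h

theorem hom_V_eq {X : Type} (G : PiGraph X) (p : (InterpPi X).obj PObj.V ⟶ G) :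
    p = vHom G (p.right PUnit.unit) := by
  apply CommaMorphism.ext
  · refine ConcreteCategory.hom_ext _ _ fun e => ?_
    exact (show Empty from e).elim
  · rfl

theorem hom_A_w {X : Type} (G : PiGraph X) (p : (InterpPi X).obj PObj.A ⟶ G) :
    G.hom (p.left PUnit.unit) = Quot.mk _ (fun x : X => p.right x) :=
  ConcreteCategory.congr_hom p.w PUnit.unit

theorem hom_A_eq {X : Type} (G : PiGraph X) (p : (InterpPi X).obj PObj.A ⟶ G) :
    p = aHom G (p.left PUnit.unit) (fun x : X => p.right x) (hom_A_w G p) := by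
  apply CommaMorphism.ext <;> rfl

section
variable {X : Type} {G : PiGraph X}
  (s : Cocone (CostructuredArrow.proj (InterpPi X) G ⋙ InterpPi X))

/-- Cocone leg at a vertex. -/
def legV (v : G.right) : (InterpPi X).obj PObj.V ⟶ s.pt :=
  s.ι.app (CostructuredArrow.mk (vHom G v))

/-- Cocone leg at a parametrised edge. -/
def legA (e : G.left) (f : X → G.right) (h : G.hom e = Quot.mk _ f) :
    (InterpPi X).obj PObj.A ⟶ s.pt :=
  s.ι.app (CostructuredArrow.mk (aHom G e f h))

theorem legA_right (e : G.left) (f : X → G.right) (h : G.hom e = Quot.mk _ f) (x : X) :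
    (legA s e f h).right x = (legV s (f x)).right PUnit.unit := by
  let m : CostructuredArrow.mk (vHom G (f x)) ⟶ CostructuredArrow.mk (aHom G e f h) :=
    CostructuredArrow.homMk (show (PObj.V : PObj X) ⟶ PObj.A from x) (by
      apply CommaMorphism.ext
      · refine ConcreteCategory.hom_ext _ _ fun e => ?_
        exact (show Empty from e).elim
      · rfl)
  have := congrArg CommaMorphism.right (s.w m)
  exact ConcreteCategory.congr_hom this PUnit.unit

theorem legA_left (e : G.left) (f g : X → G.right) (hf : G.hom e = Quot.mk _ f)
    (hg : G.hom e = Quot.mk _ g) :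
    (legA s e f hf).left PUnit.unit = (legA s e g hg).left PUnit.unit := by
  obtain ⟨σ, rfl⟩ := quot_exact (hf.symm.trans hg)
  let m : CostructuredArrow.mk (aHom G e (g ∘ σ) hf) ⟶ CostructuredArrow.mk (aHom G e g hg) :=
    CostructuredArrow.homMk (show (PObj.A : PObj X) ⟶ PObj.A from σ) (by
      apply CommaMorphism.ext <;> rfl)
  have := congrArg CommaMorphism.left (s.w m)
  exact (ConcreteCategory.congr_hom this PUnit.unit).symm

theorem exists_rep (e : G.left) : ∃ f : X → G.right, G.hom e = Quot.mk _ f := by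
  obtain ⟨f, hf⟩ := Quot.exists_rep (G.hom e)
  exact ⟨f, hf.symm⟩

/-- The induced morphism out of `G`. -/
noncomputable def descPi : G ⟶ s.pt where
  left := ↾fun e => (legA s e _ (exists_rep e).choose_spec).left PUnit.unit
  right := ↾fun v => (legV s v).right PUnit.unit
  w := by
    refine ConcreteCategory.hom_ext _ _ fun e => ?_
    have h := (exists_rep e).choose_spec
    refine (hom_A_w s.pt (legA s e _ h)).trans ?_
    refine Eq.trans ?_ (congrArg ((PiXF X).map (↾fun v => (legV s v).right PUnit.unit)) h).symm
    exact congrArg (Quot.mk _) (funext fun x => legA_right s e _ h x)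

end

/-- The interpretation functor `I : 𝔾_{(X, Aut X)} ⥤ Set ↓ Π̲_X` is dense:
for every `Π̲_X`-graph `G`, the canonical cocone from the diagram `(I ↓ G) ⥤ Set ↓ Π̲_X`
to `G` is a colimit cocone. -/
theorem statement15 (X : Type) (G : PiGraph X) :
    Nonempty (IsColimit (canonicalCocone X G)) := by
  refine ⟨{ desc := fun s => descPi s, fac := ?_, uniq := ?_ }⟩
  · rintro s ⟨o, ⟨⟨⟩⟩, p⟩
    cases o with
    | V =>
      change p ≫ descPi s = s.ι.app (CostructuredArrow.mk p)
      obtain ⟨v, rfl⟩ : ∃ v, p = vHom G v := ⟨_, hom_V_eq G p⟩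
      apply CommaMorphism.ext
      · refine ConcreteCategory.hom_ext _ _ fun e => ?_
        exact (show Empty from e).elim
      · rfl
    | A =>
      change p ≫ descPi s = s.ι.app (CostructuredArrow.mk p)
      obtain ⟨e, f, h, rfl⟩ : ∃ e f h, p = aHom G e f h := ⟨_, _, _, hom_A_eq G p⟩
      apply CommaMorphism.ext
      · refine ConcreteCategory.hom_ext _ _ fun _ => ?_
        exact legA_left s e _ f _ h
      · refine ConcreteCategory.hom_ext _ _ fun x => ?_
        exact (legA_right s e f h x).symm
  · intro s m hm
    apply CommaMorphism.ext
    · refine ConcreteCategory.hom_ext _ _ fun e => ?_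
      have h := (exists_rep (G := G) e).choose_spec
      exact ConcreteCategory.congr_hom
        (congrArg CommaMorphism.left (hm (CostructuredArrow.mk (aHom G e _ h)))) PUnit.unit
    · refine ConcreteCategory.hom_ext _ _ fun v => ?_
      exact ConcreteCategory.congr_hom
        (congrArg CommaMorphism.right (hm (CostructuredArrow.mk (vHom G v)))) PUnit.unit
end
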